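/- arXiv:1908.01865 — 2 statements merged into one kernel-verified Lean document; each statement's English description precedes it below -/
import Mathlib

section
/- Fix T > 0 sufficiently small and let 𝔉 be the set of three times continuously differentiable even functions g: [−T, T] → ℝ with g(0) = 1, g''(0) = −1 and |g(t)| ≤ 1 for all |t| ≤ T, equipped with the distance d(g₁, g₂) = sup_{0<|t|≤T} |(g₁(t) − g₂(t))/t³|. Then the operator 𝓑 defined by (𝓑g)(t) = 2·g(t/2)² − 1 maps 𝔉 into 𝔉 and is a contraction: d(𝓑g₁, 𝓑g₂) ≤ (1/2)·d(g₁, g₂) for all g₁, g₂ ∈ 𝔉. -/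
open Set

/-- The class `𝔉`: three times continuously differentiable even functions on `[-T, T]`
with `g(0) = 1`, `g''(0) = -1` and `|g(t)| ≤ 1` on `[-T, T]`. -/
def MemF (T : ℝ) (g : ℝ → ℝ) : Prop :=
  ContDiffOn ℝ 3 g (Icc (-T) T) ∧
  (∀ t ∈ Icc (-T) T, g (-t) = g t) ∧
  g 0 = 1 ∧
  iteratedDerivWithin 2 g (Icc (-T) T) 0 = -1 ∧
  ∀ t : ℝ, |t| ≤ T → |g t| ≤ 1

/-- The distance `d(g₁, g₂) = sup_{0 < |t| ≤ T} |(g₁(t) - g₂(t)) / t³|` on `𝔉`. -/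
noncomputable def distF (T : ℝ) (g₁ g₂ : ℝ → ℝ) : ℝ :=
  sSup {x : ℝ | ∃ t : ℝ, 0 < |t| ∧ |t| ≤ T ∧ x = |(g₁ t - g₂ t) / t ^ 3|}

/-- The operator `𝓑` defined by `(𝓑 g)(t) = 2 g(t/2)² - 1`. -/
noncomputable def Bop (g : ℝ → ℝ) : ℝ → ℝ := fun t => 2 * g (t / 2) ^ 2 - 1

open Topology Filter

/-- Halving preserves a symmetric interval. -/
lemma half_mem_Icc_symm {T t : ℝ} (ht : t ∈ Icc (-T) T) : t / 2 ∈ Icc (-T) T := by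
  obtain ⟨h1, h2⟩ := ht
  constructor <;> linarith

namespace MemF

variable {T : ℝ} {g : ℝ → ℝ}

lemma contDiffAt (hT : 0 < T) (hg : MemF T g) : ContDiffAt ℝ 3 g 0 :=
  hg.1.contDiffAt (Icc_mem_nhds (by linarith) hT)

lemma deriv_zero (hT : 0 < T) (hg : MemF T g) : deriv g 0 = 0 := by
  have h : (fun t => g (-t)) =ᶠ[𝓝 0] g := by
    filter_upwards [Icc_mem_nhds (show -T < 0 by linarith) hT] with t ht using hg.2.1 t ht
  have h1 := h.deriv_eq
  rw [deriv_comp_neg, neg_zero] at h1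
  linarith

lemma deriv_deriv_zero (hT : 0 < T) (hg : MemF T g) : deriv (deriv g) 0 = -1 := by
  have h := hg.2.2.2.1
  rw [iteratedDerivWithin_eq_iteratedDeriv (uniqueDiffOn_Icc (by linarith))
    ((hg.contDiffAt hT).of_le (by norm_num)) ⟨by linarith, hT.le⟩] at h
  simpa [iteratedDeriv_succ, iteratedDeriv_zero] using h

/-- Second order Taylor expansion at `0` of an element of the class. -/
lemma exists_abs_sub_le (hT : 0 < T) (hg : MemF T g) :
    ∃ C, ∀ t, |t| ≤ T → |g t - (1 - t ^ 2 / 2)| ≤ C * |t| ^ 3 := by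
  have hc : ContDiffOn ℝ 3 g (Icc 0 T) := hg.1.mono (Icc_subset_Icc_left (by linarith))
  obtain ⟨C, hC⟩ := exists_taylor_mean_remainder_bound (n := 2) hT.le (by exact_mod_cast hc)
  have h0 : (0 : ℝ) ∈ Icc 0 T := ⟨le_rfl, hT.le⟩
  have hu := uniqueDiffOn_Icc hT
  have e1 : iteratedDerivWithin 1 g (Icc 0 T) 0 = 0 := by
    rw [iteratedDerivWithin_eq_iteratedDeriv hu ((hg.contDiffAt hT).of_le (by norm_num)) h0,
      iteratedDeriv_one, hg.deriv_zero hT]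
  have e2 : iteratedDerivWithin 2 g (Icc 0 T) 0 = -1 := by
    rw [iteratedDerivWithin_eq_iteratedDeriv hu ((hg.contDiffAt hT).of_le (by norm_num)) h0]
    simpa [iteratedDeriv_succ, iteratedDeriv_zero] using hg.deriv_deriv_zero hT
  have key : ∀ t ∈ Icc 0 T, |g t - (1 - t ^ 2 / 2)| ≤ C * t ^ 3 := by
    intro t ht
    have h := hC t ht
    rw [taylorWithinEval_succ, taylorWithinEval_succ, taylor_within_zero_eval] at h
    norm_num [e1, e2, hg.2.2.1] at h
    convert h using 2
    ring
  refine ⟨C, fun t ht => ?_⟩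
  have h := key |t| ⟨abs_nonneg t, ht⟩
  have hgt : g |t| = g t := by
    rcases abs_choice t with h | h
    · rw [h]
    · rw [h, hg.2.1 t (abs_le.mp ht)]
  rwa [hgt, sq_abs] at h

lemma bddAbove_distF {g₁ g₂ : ℝ → ℝ} (hT : 0 < T) (h₁ : MemF T g₁) (h₂ : MemF T g₂) :
    BddAbove {x : ℝ | ∃ t : ℝ, 0 < |t| ∧ |t| ≤ T ∧ x = |(g₁ t - g₂ t) / t ^ 3|} := by
  obtain ⟨C₁, hC₁⟩ := h₁.exists_abs_sub_le hT
  obtain ⟨C₂, hC₂⟩ := h₂.exists_abs_sub_le hT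
  refine ⟨C₁ + C₂, ?_⟩
  rintro x ⟨t, ht0, ht, rfl⟩
  rw [abs_div, abs_pow, div_le_iff₀ (by positivity), add_mul]
  have h := abs_sub (g₁ t - (1 - t ^ 2 / 2)) (g₂ t - (1 - t ^ 2 / 2))
  rw [sub_sub_sub_cancel_right] at h
  linarith [hC₁ t ht, hC₂ t ht]

lemma deriv_deriv_Bop_zero (hT : 0 < T) (hg : MemF T g) : deriv (deriv (Bop g)) 0 = -1 := by
  have hhalf : ∀ t : ℝ, HasDerivAt (fun s : ℝ => s / 2) (1 / 2) t := fun t =>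
    (hasDerivAt_id t).div_const 2
  have hd : ∀ᶠ t in 𝓝 (0 : ℝ), DifferentiableAt ℝ g (t / 2) := by
    have hev : ∀ᶠ t in 𝓝 (0 : ℝ), DifferentiableAt ℝ g t := by
      filter_upwards [(hg.contDiffAt hT).eventually (by simp)] with t ht
      exact ht.differentiableAt (by norm_num)
    have ht : Tendsto (fun t : ℝ => t / 2) (𝓝 0) (𝓝 0) := by
      simpa using (hhalf 0).continuousAt.tendsto
    exact ht.eventually hev
  have h1 : deriv (Bop g) =ᶠ[𝓝 0] fun t => 2 * (g (t / 2) * deriv g (t / 2)) := by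
    filter_upwards [hd] with t ht
    have h := ((((ht.hasDerivAt.comp t (hhalf t)).pow 2).const_mul 2).sub_const 1).deriv
    refine Eq.trans h ?_
    simp only [Function.comp]
    ring
  rw [h1.deriv_eq]
  have hd0 : HasDerivAt g (deriv g 0) ((0 : ℝ) / 2) := by
    simpa using ((hg.contDiffAt hT).differentiableAt (by norm_num)).hasDerivAt
  have hd1 : HasDerivAt (deriv g) (deriv (deriv g) 0) ((0 : ℝ) / 2) := by
    have : ContDiffAt ℝ 2 (deriv g) 0 := (hg.contDiffAt hT).derivWithin (by norm_num)
    simpa using (this.differentiableAt (by norm_num)).hasDerivAt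
  have h := (((hd0.comp 0 (hhalf 0)).mul (hd1.comp 0 (hhalf 0))).const_mul 2).deriv
  refine Eq.trans h ?_
  simp [hg.deriv_zero hT, hg.deriv_deriv_zero hT, hg.2.2.1]

lemma bop (hT : 0 < T) (hg : MemF T g) : MemF T (Bop g) := by
  have hc : ContDiffOn ℝ 3 (Bop g) (Icc (-T) T) := by
    have h : ContDiffOn ℝ 3 (fun t => g (t / 2)) (Icc (-T) T) :=
      hg.1.comp (contDiff_id.div_const 2).contDiffOn fun t ht => half_mem_Icc_symm ht
    exact (contDiffOn_const.mul (h.pow 2)).sub contDiffOn_const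
  refine ⟨hc, fun t ht => ?_, ?_, ?_, fun t ht => ?_⟩
  · simp only [Bop, neg_div, hg.2.1 _ (half_mem_Icc_symm ht)]
  · norm_num [Bop, hg.2.2.1]
  · rw [iteratedDerivWithin_eq_iteratedDeriv (uniqueDiffOn_Icc (by linarith))
      ((hc.contDiffAt (Icc_mem_nhds (by linarith) hT)).of_le (by norm_num)) ⟨by linarith, hT.le⟩]
    simpa [iteratedDeriv_succ, iteratedDeriv_zero] using hg.deriv_deriv_Bop_zero hT
  · have h := hg.2.2.2.2 (t / 2) (abs_le.mpr (half_mem_Icc_symm (abs_le.mp ht)))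
    have h2 := (sq_le_one_iff_abs_le_one _).mpr h
    rw [Bop, abs_le]
    constructor <;> nlinarith [sq_nonneg (g (t / 2))]

lemma distF_Bop_le {g₁ g₂ : ℝ → ℝ} (hT : 0 < T) (h₁ : MemF T g₁) (h₂ : MemF T g₂) :
    distF T (Bop g₁) (Bop g₂) ≤ 1 / 2 * distF T g₁ g₂ := by
  refine csSup_le ⟨_, T, abs_pos.mpr hT.ne', (abs_of_pos hT).le, rfl⟩ ?_
  rintro x ⟨t, ht0, ht, rfl⟩
  have hs : |t / 2| ≤ T := abs_le.mpr (half_mem_Icc_symm (abs_le.mp ht))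
  have ht' : t ≠ 0 := abs_pos.mp ht0
  have hle : |(g₁ (t / 2) - g₂ (t / 2)) / (t / 2) ^ 3| ≤ distF T g₁ g₂ :=
    le_csSup (bddAbove_distF hT h₁ h₂) ⟨t / 2, abs_pos.mpr (by positivity), hs, rfl⟩
  have hsum : |(g₁ (t / 2) + g₂ (t / 2)) / 4| ≤ 1 / 2 := by
    rw [abs_div, abs_of_pos (show (0 : ℝ) < 4 by norm_num)]
    linarith [abs_add_le (g₁ (t / 2)) (g₂ (t / 2)), h₁.2.2.2.2 _ hs, h₂.2.2.2.2 _ hs]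
  have heq : (Bop g₁ t - Bop g₂ t) / t ^ 3 =
      (g₁ (t / 2) + g₂ (t / 2)) / 4 * ((g₁ (t / 2) - g₂ (t / 2)) / (t / 2) ^ 3) := by
    simp only [Bop]
    field_simp
    ring
  rw [heq, abs_mul]
  exact mul_le_mul hsum hle (abs_nonneg _) (by norm_num)

end MemF

/-- For `T > 0` sufficiently small, the operator `𝓑` maps `𝔉` into `𝔉`
and is a contraction with constant `1/2` for the distance `d`. -/
theorem Bop_maps_and_contracts :
    ∃ T₀ > (0 : ℝ), ∀ T : ℝ, 0 < T → T ≤ T₀ →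
      (∀ g : ℝ → ℝ, MemF T g → MemF T (Bop g)) ∧
      ∀ g₁ g₂ : ℝ → ℝ, MemF T g₁ → MemF T g₂ →
        distF T (Bop g₁) (Bop g₂) ≤ 1 / 2 * distF T g₁ g₂ := by
  exact ⟨1, one_pos, fun T hT _ =>
    ⟨fun _ hg => hg.bop hT, fun _ _ h₁ h₂ => MemF.distF_Bop_le hT h₁ h₂⟩⟩
end

section
/- Fix T > 0 sufficiently small and let 𝔉 be the set of three times continuously differentiable even functions g: [−T, T] → ℝ with g(0) = 1, g''(0) = −1 and |g(t)| ≤ 1 for all |t| ≤ T. If g ∈ 𝔉 satisfies g(t) = 2·g(t/2)² − 1 for all t ∈ [−T, T], then g(t) = cos(t) for all t ∈ [−T, T]. -/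
open Set

open Filter Topology Asymptotics

/-- A function which is even on a symmetric interval has vanishing derivative at `0`. -/
lemma derivWithin_zero_of_even {T : ℝ} (hT : 0 < T) {g : ℝ → ℝ}
    (hg : ∀ t ∈ Icc (-T) T, g (-t) = g t) : derivWithin g (Icc (-T) T) 0 = 0 := by
  have hnhds : Icc (-T) T ∈ 𝓝 (0 : ℝ) := Icc_mem_nhds (by linarith) hT
  rw [derivWithin_of_mem_nhds hnhds]
  have heq : (fun t => g (-t)) =ᶠ[𝓝 0] g := by filter_upwards [hnhds] using hg
  have := heq.deriv_eq
  rw [deriv_comp_neg, neg_zero] at this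
  linarith

/-- An element of `𝔉` agrees with `cos` to second order at `0`. -/
lemma MemF.sub_cos_isLittleO {T : ℝ} (hT : 0 < T) {g : ℝ → ℝ} (hg : MemF T g) :
    (fun t => g t - Real.cos t) =o[𝓝 0] fun t => t ^ 2 := by
  obtain ⟨hsmooth, heven, hzero, hsecond, -⟩ := hg
  have hnhds : Icc (-T) T ∈ 𝓝 (0 : ℝ) := Icc_mem_nhds (by linarith) hT
  have hmem : (0 : ℝ) ∈ Icc (-T) T := mem_of_mem_nhds hnhds
  have huniq : UniqueDiffOn ℝ (Icc (-T) T) := uniqueDiffOn_Icc (by linarith)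
  have hG := taylor_isLittleO (n := 2) (convex_Icc (-T) T) hmem (hsmooth.of_le (by norm_num))
  have hC := taylor_isLittleO (n := 2) (convex_Icc (-T) T) hmem
    Real.contDiff_cos.contDiffOn
  have hcos : iteratedDerivWithin 2 Real.cos (Icc (-T) T) 0 = -1 := by
    rw [iteratedDerivWithin_eq_iteratedDeriv huniq Real.contDiff_cos.contDiffAt hmem]
    simp [iteratedDeriv_succ]
  have hD := hG.sub hC
  simp only [nhdsWithin_eq_nhds.2 hnhds, taylorWithinEval_succ, taylor_within_zero_eval,
    sub_zero, zero_add, iteratedDerivWithin_one, derivWithin_zero_of_even hT heven,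
    derivWithin_zero_of_even hT (fun t _ => Real.cos_neg t), hsecond, one_add_one_eq_two,
    hcos, hzero, Real.cos_zero, sub_sub_sub_cancel_right] at hD
  exact hD

/-- The doubling map expands the distance between functions bounded by `1` at most fourfold. -/
lemma abs_doubling_sub_le {a b : ℝ} (ha : |a| ≤ 1) (hb : |b| ≤ 1) :
    |(2 * a ^ 2 - 1) - (2 * b ^ 2 - 1)| ≤ 4 * |a - b| := by
  have hab : |a + b| ≤ 2 := (abs_add_le a b).trans (by linarith)
  calc |(2 * a ^ 2 - 1) - (2 * b ^ 2 - 1)| = 2 * |a + b| * |a - b| := by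
        rw [← abs_two, ← abs_mul, ← abs_mul, abs_two]; ring_nf
    _ ≤ 4 * |a - b| := by gcongr; linarith

/-- A function growing at most fourfold when the argument doubles and which is `o(t ^ 2)` at `0`
vanishes. -/
lemma eq_zero_of_abs_le_four_mul {T : ℝ} {h : ℝ → ℝ} (ho : h =o[𝓝 0] fun t => t ^ 2)
    (hle : ∀ t ∈ Icc (-T) T, |h t| ≤ 4 * |h (t / 2)|) {t : ℝ} (ht : t ∈ Icc (-T) T) :
    h t = 0 := by
  have hmem (n : ℕ) : t / 2 ^ n ∈ Icc (-T) T := by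
    rw [mem_Icc, ← abs_le] at ht ⊢
    rw [abs_div, abs_of_pos (by positivity : (0 : ℝ) < 2 ^ n)]
    exact (div_le_self (abs_nonneg t) (one_le_pow₀ one_le_two)).trans ht
  have hiter (n : ℕ) : |h t| ≤ 4 ^ n * |h (t / 2 ^ n)| := by
    induction n with
    | zero => simp
    | succ n ih =>
      have := hle _ (hmem n)
      rw [div_div, ← pow_succ] at this
      calc |h t| ≤ 4 ^ n * |h (t / 2 ^ n)| := ih
        _ ≤ 4 ^ n * (4 * |h (t / 2 ^ (n + 1))|) := by gcongr
        _ = 4 ^ (n + 1) * |h (t / 2 ^ (n + 1))| := by ring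
  have hlim : Tendsto (fun n : ℕ => t / 2 ^ n) atTop (𝓝 0) :=
    tendsto_const_nhds.div_atTop (tendsto_pow_atTop_atTop_of_one_lt one_lt_two)
  have hscaled : Tendsto (fun n : ℕ => 4 ^ n * |h (t / 2 ^ n)|) atTop (𝓝 0) := by
    have hpow : (fun n : ℕ => (4 : ℝ) ^ n * (t / 2 ^ n) ^ 2) = fun _ => t ^ 2 := by
      funext n
      rw [div_pow, ← pow_mul, mul_comm n 2, pow_mul]
      norm_num
      field_simp
    have := (isBigO_refl (fun n : ℕ => (4 : ℝ) ^ n) atTop).mul_isLittleO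
      (ho.comp_tendsto hlim).abs_left
    simp only [Function.comp_def, hpow] at this
    exact (this.trans_isBigO (isBigO_const_const _ one_ne_zero _)).tendsto_zero_of_tendsto
      (tendsto_const_nhds (x := (1 : ℝ)))
  exact abs_nonpos_iff.1 (ge_of_tendsto' hscaled hiter)

/-- For `T > 0` sufficiently small, any `g ∈ 𝔉` satisfying the doubling
equation `g(t) = 2 g(t/2)² - 1` on `[-T, T]` coincides with `cos` on `[-T, T]`. -/
theorem doubling_fixed_point_is_cos :
    ∃ T₀ > (0 : ℝ), ∀ T : ℝ, 0 < T → T ≤ T₀ →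
      ∀ g : ℝ → ℝ, MemF T g →
        (∀ t ∈ Icc (-T) T, g t = 2 * g (t / 2) ^ 2 - 1) →
        ∀ t ∈ Icc (-T) T, g t = Real.cos t := by
  refine ⟨1, one_pos, fun T hT _ g hg hdouble t ht => ?_⟩
  refine sub_eq_zero.1 (eq_zero_of_abs_le_four_mul (hg.sub_cos_isLittleO hT) (fun s hs => ?_) ht)
  have hhalf : |s / 2| ≤ T := by
    rw [abs_le]
    constructor <;> linarith [hs.1, hs.2]
  have hcos : Real.cos s = 2 * Real.cos (s / 2) ^ 2 - 1 := by
    rw [← Real.cos_two_mul, mul_div_cancel₀ s two_ne_zero]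
  rw [hdouble s hs, hcos]
  exact abs_doubling_sub_le (hg.2.2.2.2 _ hhalf) (Real.abs_cos_le_one _)
end
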